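/- arXiv:2306.09739 — 5 statements merged into one kernel-verified Lean document; each statement's English description precedes it below -/
import Mathlib

section
/- Let n, m be positive integers, f : ℝⁿ → ℝⁿ, F : ℝⁿ → ℝ^{n×m}, γ ≥ 0, λ₀ > 0, γ₀ > 0, and let g : ℝⁿ → ℝᵐ be differentiable with Jacobian matrix G(u) ∈ ℝ^{m×n}. Let u : [0,∞) → ℝⁿ be a differentiable solution of the stabilized equation u'(t) = f(u(t)) − γ F(u(t)) g(u(t)) such that for all t ≥ 0: (i) ‖G(u(t)) · f(u(t))‖ ≤ γ₀ ‖g(u(t))‖, and (ii) ⟨x, G(u(t)) F(u(t)) x⟩ ≥ λ₀ ‖x‖² for all x ∈ ℝᵐ. Then the function V(t) = ½‖g(u(t))‖² satisfies V'(t) ≤ 2(γ₀ − γλ₀) V(t) for all t ≥ 0. (Differential inequality at the core of Theorem 2.) -/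
open scoped RealInnerProductSpace

/-- Differential inequality at the core of Theorem 2: along a solution `u` of
the stabilized equation `u' = f (u) - γ F (u) g (u)` on `[0, ∞)` satisfying
`‖G (u) f (u)‖ ≤ γ₀ ‖g (u)‖` and `⟪x, G (u) F (u) x⟫ ≥ lam₀ ‖x‖²`, the Lyapunov
function `V (t) = ½ ‖g (u t)‖²` satisfies `V' (t) ≤ 2 (γ₀ - γ lam₀) V (t)`. -/
theorem stmt_4 (n m : ℕ) (hn : 0 < n) (hm : 0 < m)
    (f : EuclideanSpace ℝ (Fin n) → EuclideanSpace ℝ (Fin n))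
    (F : EuclideanSpace ℝ (Fin n) → Matrix (Fin n) (Fin m) ℝ)
    (γ γ₀ lam₀ : ℝ) (hγ : 0 ≤ γ) (hγ₀ : 0 < γ₀) (hlam₀ : 0 < lam₀)
    (g : EuclideanSpace ℝ (Fin n) → EuclideanSpace ℝ (Fin m))
    (G : EuclideanSpace ℝ (Fin n) → Matrix (Fin m) (Fin n) ℝ)
    (hg : ∀ x : EuclideanSpace ℝ (Fin n),
      HasFDerivAt g ((Matrix.toEuclideanLin (G x)).toContinuousLinearMap) x)
    (u : ℝ → EuclideanSpace ℝ (Fin n))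
    (hu : ∀ t : ℝ, 0 ≤ t → HasDerivWithinAt u
      (f (u t) - γ • Matrix.toEuclideanLin (F (u t)) (g (u t))) (Set.Ici (0 : ℝ)) t)
    (hbound : ∀ t : ℝ, 0 ≤ t →
      ‖Matrix.toEuclideanLin (G (u t)) (f (u t))‖ ≤ γ₀ * ‖g (u t)‖)
    (hposdef : ∀ t : ℝ, 0 ≤ t → ∀ x : EuclideanSpace ℝ (Fin m),
      lam₀ * ‖x‖ ^ 2 ≤ ⟪x, Matrix.toEuclideanLin (G (u t) * F (u t)) x⟫) :
    ∀ t : ℝ, 0 ≤ t →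
      derivWithin (fun s => (1 / 2 : ℝ) * ‖g (u s)‖ ^ 2) (Set.Ici (0 : ℝ)) t ≤
        2 * (γ₀ - γ * lam₀) * ((1 / 2 : ℝ) * ‖g (u t)‖ ^ 2) := by
  intro t ht
  have hV : HasDerivWithinAt (fun s => (1 / 2 : ℝ) * ‖g (u s)‖ ^ 2) _ (Set.Ici (0 : ℝ)) t :=
    ((hg (u t)).comp_hasDerivWithinAt t (hu t ht)).norm_sq.const_mul (1 / 2 : ℝ)
  rw [hV.derivWithin (uniqueDiffOn_Ici 0 t ht)]
  have hmul : Matrix.toEuclideanLin (G (u t)) (Matrix.toEuclideanLin (F (u t)) (g (u t))) =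
      Matrix.toEuclideanLin (G (u t) * F (u t)) (g (u t)) := by
    simp [Matrix.toLpLin_apply, Matrix.mulVec_mulVec]
  have hdrift : ⟪g (u t), Matrix.toEuclideanLin (G (u t)) (f (u t))⟫ ≤ γ₀ * ‖g (u t)‖ ^ 2 :=
    calc _ ≤ ‖g (u t)‖ * ‖Matrix.toEuclideanLin (G (u t)) (f (u t))‖ := real_inner_le_norm _ _
      _ ≤ ‖g (u t)‖ * (γ₀ * ‖g (u t)‖) := by gcongr; exact hbound t ht
      _ = _ := by ring
  have hstab := mul_le_mul_of_nonneg_left (hposdef t ht (g (u t))) hγ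
  simp only [Function.comp_apply, LinearMap.coe_toContinuousLinearMap', map_sub, map_smul,
    inner_sub_right, real_inner_smul_right, hmul]
  linarith
end

section
/- Let n, m be positive integers, f : ℝⁿ → ℝⁿ, F : ℝⁿ → ℝ^{n×m}, γ ≥ 0, λ₀ > 0, γ₀ > 0, and let g : ℝⁿ → ℝᵐ be differentiable with Jacobian matrix G(u) ∈ ℝ^{m×n}. Let u : [0,∞) → ℝⁿ be a differentiable solution of the stabilized equation u'(t) = f(u(t)) − γ F(u(t)) g(u(t)) such that for all t ≥ 0: (i) ‖G(u(t)) · f(u(t))‖ ≤ γ₀ ‖g(u(t))‖, and (ii) ⟨x, G(u(t)) F(u(t)) x⟩ ≥ λ₀ ‖x‖² for all x ∈ ℝᵐ. Then for all t ≥ 0, ‖g(u(t))‖ ≤ ‖g(u(0))‖ · exp((γ₀ − γλ₀) t). In particular, if γ ≥ γ₀/λ₀ then ‖g(u(t))‖ ≤ ‖g(u(0))‖ for all t ≥ 0, and if γ > γ₀/λ₀ then g(u(t)) → 0 as t → ∞. (Theorem 2: asymptotic stability of the constraint manifold in the SNDE for sufficiently large γ.) -/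
open scoped RealInnerProductSpace

/-- Grönwall's inequality in inner product form: if `⟪v, v'⟫ ≤ c ‖v‖²` on `[0, ∞)`, then `‖v‖`
grows at most exponentially with rate `c`. -/
theorem norm_le_norm_mul_exp_of_inner_deriv_le {E : Type*} [NormedAddCommGroup E]
    [InnerProductSpace ℝ E] {v v' : ℝ → E} {c : ℝ}
    (hv : ∀ t : ℝ, 0 ≤ t → HasDerivWithinAt v (v' t) (Set.Ici (0 : ℝ)) t)
    (hc : ∀ t : ℝ, 0 ≤ t → ⟪v t, v' t⟫ ≤ c * ‖v t‖ ^ 2) {t : ℝ} (ht : 0 ≤ t) :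
    ‖v t‖ ≤ ‖v 0‖ * Real.exp (c * t) := by
  have hderiv : ∀ s : ℝ, 0 ≤ s → HasDerivWithinAt
      (fun s => ‖v s‖ ^ 2 * Real.exp (-(2 * c) * s))
      (2 * ⟪v s, v' s⟫ * Real.exp (-(2 * c) * s) +
        ‖v s‖ ^ 2 * (Real.exp (-(2 * c) * s) * (-(2 * c) * 1))) (Set.Ici (0 : ℝ)) s :=
    fun s hs => (hv s hs).norm_sq.mul
      (((hasDerivAt_id s).const_mul (-(2 * c))).exp.hasDerivWithinAt)
  have hanti : AntitoneOn (fun s => ‖v s‖ ^ 2 * Real.exp (-(2 * c) * s)) (Set.Ici (0 : ℝ)) := by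
    refine antitoneOn_of_hasDerivWithinAt_nonpos (convex_Ici 0)
      (fun s hs => (hderiv s hs).continuousWithinAt)
      (fun s hs => (hderiv s (interior_subset hs)).mono interior_subset) fun s hs => ?_
    have := mul_nonneg (Real.exp_pos (-(2 * c) * s)).le
      (sub_nonneg.2 (hc s (interior_subset hs)))
    linarith
  have hle : ‖v t‖ ^ 2 * Real.exp (-(2 * c) * t) ≤ ‖v 0‖ ^ 2 := by
    simpa using hanti Set.self_mem_Ici (Set.mem_Ici.2 ht) ht
  refine (pow_le_pow_iff_left₀ (norm_nonneg _) (by positivity) two_ne_zero).1 ?_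
  calc ‖v t‖ ^ 2 = ‖v t‖ ^ 2 * Real.exp (-(2 * c) * t) * Real.exp (c * t) ^ 2 := by
        rw [mul_assoc, ← Real.exp_nat_mul, ← Real.exp_add]
        have : -(2 * c) * t + (2 : ℕ) * (c * t) = 0 := by push_cast; ring
        rw [this, Real.exp_zero, mul_one]
    _ ≤ ‖v 0‖ ^ 2 * Real.exp (c * t) ^ 2 := by gcongr
    _ = (‖v 0‖ * Real.exp (c * t)) ^ 2 := (mul_pow _ _ _).symm

/-- Theorem 2: along a solution `u` of the stabilized equation
`u' = f (u) - γ F (u) g (u)` on `[0, ∞)` satisfying `‖G (u) f (u)‖ ≤ γ₀ ‖g (u)‖`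
and `⟪x, G (u) F (u) x⟫ ≥ λ₀ ‖x‖²` (i.e. `G (u) F (u)` positive definite with
smallest eigenvalue at least `λ₀ > 0`), one has
`‖g (u t)‖ ≤ ‖g (u 0)‖ exp ((γ₀ - γ λ₀) t)`. In particular the constraint is
non-increasing when `γ ≥ γ₀ / λ₀` and `g (u t) → 0` when `γ > γ₀ / λ₀`
(asymptotic stability of the constraint manifold). -/
theorem stmt_5 (n m : ℕ) (hn : 0 < n) (hm : 0 < m)
    (f : EuclideanSpace ℝ (Fin n) → EuclideanSpace ℝ (Fin n))
    (F : EuclideanSpace ℝ (Fin n) → Matrix (Fin n) (Fin m) ℝ)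
    (γ γ₀ lam₀ : ℝ) (hγ : 0 ≤ γ) (hγ₀ : 0 < γ₀) (hlam₀ : 0 < lam₀)
    (g : EuclideanSpace ℝ (Fin n) → EuclideanSpace ℝ (Fin m))
    (G : EuclideanSpace ℝ (Fin n) → Matrix (Fin m) (Fin n) ℝ)
    (hg : ∀ x : EuclideanSpace ℝ (Fin n),
      HasFDerivAt g ((Matrix.toEuclideanLin (G x)).toContinuousLinearMap) x)
    (u : ℝ → EuclideanSpace ℝ (Fin n))
    (hu : ∀ t : ℝ, 0 ≤ t → HasDerivWithinAt u
      (f (u t) - γ • Matrix.toEuclideanLin (F (u t)) (g (u t))) (Set.Ici (0 : ℝ)) t)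
    (hbound : ∀ t : ℝ, 0 ≤ t →
      ‖Matrix.toEuclideanLin (G (u t)) (f (u t))‖ ≤ γ₀ * ‖g (u t)‖)
    (hposdef : ∀ t : ℝ, 0 ≤ t → ∀ x : EuclideanSpace ℝ (Fin m),
      lam₀ * ‖x‖ ^ 2 ≤ ⟪x, Matrix.toEuclideanLin (G (u t) * F (u t)) x⟫) :
    (∀ t : ℝ, 0 ≤ t →
      ‖g (u t)‖ ≤ ‖g (u 0)‖ * Real.exp ((γ₀ - γ * lam₀) * t)) ∧
    (γ₀ / lam₀ ≤ γ → ∀ t : ℝ, 0 ≤ t → ‖g (u t)‖ ≤ ‖g (u 0)‖) ∧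
    (γ₀ / lam₀ < γ →
      Filter.Tendsto (fun t => g (u t)) Filter.atTop (nhds 0)) := by
  have hexp : ∀ t : ℝ, 0 ≤ t →
      ‖g (u t)‖ ≤ ‖g (u 0)‖ * Real.exp ((γ₀ - γ * lam₀) * t) := by
    intro t ht
    refine norm_le_norm_mul_exp_of_inner_deriv_le (v := fun s => g (u s))
      (fun s hs => (hg (u s)).comp_hasDerivWithinAt s (hu s hs)) (fun s hs => ?_) ht
    have hGF : Matrix.toEuclideanLin (G (u s)) (Matrix.toEuclideanLin (F (u s)) (g (u s))) =
        Matrix.toEuclideanLin (G (u s) * F (u s)) (g (u s)) := by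
      simp [Matrix.toLpLin_apply, Matrix.mulVec_mulVec]
    rw [LinearMap.coe_toContinuousLinearMap', map_sub, map_smul, hGF, inner_sub_right,
      real_inner_smul_right]
    have h₁ : ⟪g (u s), Matrix.toEuclideanLin (G (u s)) (f (u s))⟫ ≤
        ‖g (u s)‖ * (γ₀ * ‖g (u s)‖) :=
      (real_inner_le_norm _ _).trans (by gcongr; exact hbound s hs)
    have h₂ := mul_le_mul_of_nonneg_left (hposdef s hs (g (u s))) hγ
    linarith
  refine ⟨hexp, fun h t ht => (hexp t ht).trans (mul_le_of_le_one_right (norm_nonneg _) ?_),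
    fun h => ?_⟩
  · rw [div_le_iff₀ hlam₀] at h
    exact Real.exp_le_one_iff.2 (mul_nonpos_of_nonpos_of_nonneg (by linarith) ht)
  · rw [div_lt_iff₀ hlam₀] at h
    refine squeeze_zero_norm' (Filter.eventually_atTop.2 ⟨0, hexp⟩) ?_
    simpa using (Real.tendsto_exp_atBot.comp
      (Filter.tendsto_id.const_mul_atTop_of_neg (sub_neg.2 h))).const_mul ‖g (u 0)‖
end

section
/- Let n, m be positive integers, f : ℝⁿ → ℝⁿ, F : ℝⁿ → ℝ^{n×m}, γ ≥ 0, λ₀ > 0, γ₀ > 0, and let g : ℝⁿ → ℝᵐ be differentiable with Jacobian matrix G(u) ∈ ℝ^{m×n}. Let u : [0,∞) → ℝⁿ be a differentiable solution of the stabilized equation u'(t) = f(u(t)) − γ F(u(t)) g(u(t)) such that for all t ≥ 0: (i) ‖G(u(t)) · f(u(t))‖ ≤ γ₀ ‖g(u(t))‖, and (ii) ⟨x, G(u(t)) F(u(t)) x⟩ ≥ λ₀ ‖x‖² for all x ∈ ℝᵐ. If g(u(0)) = 0, then g(u(t)) = 0 for all t ≥ 0, i.e., a solution of the SNDE starting on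 the constraint manifold remains on it for all time. -/
open scoped RealInnerProductSpace

/-- A curve that starts at `0` and whose velocity satisfies the one-sided bound
`⟪w, w'⟫ ≤ K ‖w‖²` vanishes identically. -/
theorem eq_zero_of_inner_deriv_le {E : Type*} [NormedAddCommGroup E] [InnerProductSpace ℝ E]
    {w w' : ℝ → E} {K a : ℝ}
    (hw : ∀ t, a ≤ t → HasDerivWithinAt w (w' t) (Set.Ici a) t) (ha : w a = 0)
    (bound : ∀ t, a ≤ t → ⟪w t, w' t⟫ ≤ K * ‖w t‖ ^ 2) :
    ∀ t, a ≤ t → w t = 0 := by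
  intro t ht
  have hderiv : ∀ s, a ≤ s →
      HasDerivWithinAt (fun r => ‖w r‖ ^ 2) (2 * ⟪w s, w' s⟫) (Set.Ici a) s :=
    fun s hs => (hw s hs).norm_sq
  have hle : ‖w t‖ ^ 2 ≤ gronwallBound 0 (2 * K) 0 (t - a) := by
    refine le_gronwallBound_of_liminf_deriv_right_le (f := fun r => ‖w r‖ ^ 2)
      (f' := fun s => 2 * ⟪w s, w' s⟫) (b := t) ?_ ?_ (by simp [ha]) ?_ t ⟨ht, le_rfl⟩
    · exact fun s hs => (hderiv s hs.1).continuousWithinAt.mono Set.Icc_subset_Ici_self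
    · intro s hs r hr
      have hfreq := ((hderiv s hs.1).mono (Set.Ici_subset_Ici.2 hs.1)).liminf_right_slope_le hr
      exact hfreq.mono fun z hz => by rwa [slope_def_field, div_eq_inv_mul] at hz
    · intro s hs
      linarith [bound s hs.1]
  rw [gronwallBound_ε0_δ0] at hle
  simpa using le_antisymm hle (sq_nonneg _)

/-- A solution of the SNDE starting on the constraint manifold remains on it for
all time: along a solution `u` of `u' = f (u) - γ F (u) g (u)` on `[0, ∞)`
satisfying `‖G (u) f (u)‖ ≤ γ₀ ‖g (u)‖` and `⟪x, G (u) F (u) x⟫ ≥ λ₀ ‖x‖²`,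
if `g (u 0) = 0` then `g (u t) = 0` for all `t ≥ 0`. -/
theorem stmt_6 (n m : ℕ) (hn : 0 < n) (hm : 0 < m)
    (f : EuclideanSpace ℝ (Fin n) → EuclideanSpace ℝ (Fin n))
    (F : EuclideanSpace ℝ (Fin n) → Matrix (Fin n) (Fin m) ℝ)
    (γ γ₀ lam₀ : ℝ) (hγ : 0 ≤ γ) (hγ₀ : 0 < γ₀) (hlam₀ : 0 < lam₀)
    (g : EuclideanSpace ℝ (Fin n) → EuclideanSpace ℝ (Fin m))
    (G : EuclideanSpace ℝ (Fin n) → Matrix (Fin m) (Fin n) ℝ)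
    (hg : ∀ x : EuclideanSpace ℝ (Fin n),
      HasFDerivAt g ((Matrix.toEuclideanLin (G x)).toContinuousLinearMap) x)
    (u : ℝ → EuclideanSpace ℝ (Fin n))
    (hu : ∀ t : ℝ, 0 ≤ t → HasDerivWithinAt u
      (f (u t) - γ • Matrix.toEuclideanLin (F (u t)) (g (u t))) (Set.Ici (0 : ℝ)) t)
    (hbound : ∀ t : ℝ, 0 ≤ t →
      ‖Matrix.toEuclideanLin (G (u t)) (f (u t))‖ ≤ γ₀ * ‖g (u t)‖)
    (hposdef : ∀ t : ℝ, 0 ≤ t → ∀ x : EuclideanSpace ℝ (Fin m),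
      lam₀ * ‖x‖ ^ 2 ≤ ⟪x, Matrix.toEuclideanLin (G (u t) * F (u t)) x⟫)
    (h0 : g (u 0) = 0) :
    ∀ t : ℝ, 0 ≤ t → g (u t) = 0 := by
  refine eq_zero_of_inner_deriv_le (w := fun t => g (u t)) (K := γ₀)
    (fun t ht => (hg (u t)).comp_hasDerivWithinAt t (hu t ht)) h0 ?_
  intro t ht
  have hmul : Matrix.toEuclideanLin (G (u t)) (Matrix.toEuclideanLin (F (u t)) (g (u t))) =
      Matrix.toEuclideanLin (G (u t) * F (u t)) (g (u t)) := by
    simp [Matrix.toLpLin_apply]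
  have hdrift : ⟪g (u t), Matrix.toEuclideanLin (G (u t)) (f (u t))⟫ ≤ γ₀ * ‖g (u t)‖ ^ 2 :=
    calc
      _ ≤ ‖g (u t)‖ * ‖Matrix.toEuclideanLin (G (u t)) (f (u t))‖ := real_inner_le_norm _ _
      _ ≤ ‖g (u t)‖ * (γ₀ * ‖g (u t)‖) := by gcongr; exact hbound t ht
      _ = γ₀ * ‖g (u t)‖ ^ 2 := by ring
  have hstab : 0 ≤ γ * ⟪g (u t), Matrix.toEuclideanLin (G (u t) * F (u t)) (g (u t))⟫ :=
    mul_nonneg hγ (le_trans (by positivity) (hposdef t ht (g (u t))))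
  rw [LinearMap.coe_toContinuousLinearMap', map_sub, map_smul, hmul, inner_sub_right,
    real_inner_smul_right]
  linarith
end

section
/- Let n, m be positive integers with m ≤ n, f : ℝⁿ → ℝⁿ, γ ≥ 0, γ₀ > 0, and let g : ℝⁿ → ℝᵐ be differentiable with Jacobian matrix G(u) ∈ ℝ^{m×n}. Let u : [0,∞) → ℝⁿ be a differentiable curve such that for all t ≥ 0, G(u(t))·G(u(t))ᵀ is invertible, ‖G(u(t)) · f(u(t))‖ ≤ γ₀ ‖g(u(t))‖, and u solves the practical SNDE u'(t) = f(u(t)) − γ · G(u(t))ᵀ(G(u(t))G(u(t))ᵀ)⁻¹ · g(u(t)). Then for all t ≥ 0, ‖g(u(t))‖ ≤ ‖g(u(0))‖ · exp((γ₀ − γ) t); in particular the constraint manifold M = {u : g(u) = 0} is asymptotically stable in the practical SNDE whenever γ > γ₀. -/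
open Matrix

/-- A Grönwall-type estimate: a curve `w` with `w' = a - γ w` and `‖a‖ ≤ γ₀ ‖w‖` satisfies
`‖w t‖ ≤ ‖w 0‖ exp ((γ₀ - γ) t)`. -/
theorem norm_le_mul_exp_of_hasDerivWithinAt {E : Type*} [NormedAddCommGroup E]
    [InnerProductSpace ℝ E] {w a : ℝ → E} {γ γ₀ : ℝ}
    (hw : ∀ t, 0 ≤ t → HasDerivWithinAt w (a t - γ • w t) (Set.Ici 0) t)
    (ha : ∀ t, 0 ≤ t → ‖a t‖ ≤ γ₀ * ‖w t‖) {t : ℝ} (ht : 0 ≤ t) :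
    ‖w t‖ ≤ ‖w 0‖ * Real.exp ((γ₀ - γ) * t) := by
  have hderiv : ∀ s, 0 ≤ s → HasDerivWithinAt
      (fun s => ‖w s‖ ^ 2 * Real.exp (-(2 * (γ₀ - γ)) * s))
      (2 * inner ℝ (w s) (a s - γ • w s) * Real.exp (-(2 * (γ₀ - γ)) * s) +
        ‖w s‖ ^ 2 * (Real.exp (-(2 * (γ₀ - γ)) * s) * -(2 * (γ₀ - γ)))) (Set.Ici 0) s := by
    intro s hs
    refine (hw s hs).norm_sq.mul (HasDerivAt.hasDerivWithinAt ?_)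
    simpa using ((hasDerivAt_id s).const_mul (-(2 * (γ₀ - γ)))).exp
  have hanti := antitoneOn_of_hasDerivWithinAt_nonpos (convex_Ici (0 : ℝ))
    (fun s hs => (hderiv s hs).continuousWithinAt)
    (fun s hs => (hderiv s (interior_subset hs)).mono interior_subset)
    (fun s hs => by
      have hinner : inner ℝ (w s) (a s) ≤ γ₀ * ‖w s‖ ^ 2 := by
        nlinarith [real_inner_le_norm (w s) (a s), ha s (interior_subset hs),
          norm_nonneg (w s)]
      rw [inner_sub_right, real_inner_smul_right, real_inner_self_eq_norm_sq]
      nlinarith [mul_le_mul_of_nonneg_right hinner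
        (Real.exp_pos (-(2 * (γ₀ - γ)) * s)).le])
  have hle : ‖w t‖ ^ 2 * Real.exp (-(2 * (γ₀ - γ)) * t) ≤ ‖w 0‖ ^ 2 := by
    simpa using hanti Set.self_mem_Ici ht ht
  have hsq : Real.exp (-(2 * (γ₀ - γ)) * t) * Real.exp ((γ₀ - γ) * t) ^ 2 = 1 := by
    rw [sq, ← Real.exp_add, ← Real.exp_add, Real.exp_eq_one_iff]
    ring
  refine le_of_sq_le_sq ?_ (by positivity)
  calc ‖w t‖ ^ 2
      = ‖w t‖ ^ 2 * Real.exp (-(2 * (γ₀ - γ)) * t) * Real.exp ((γ₀ - γ) * t) ^ 2 := by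
        rw [mul_assoc, hsq, mul_one]
    _ ≤ ‖w 0‖ ^ 2 * Real.exp ((γ₀ - γ) * t) ^ 2 := by gcongr
    _ = (‖w 0‖ * Real.exp ((γ₀ - γ) * t)) ^ 2 := by ring

/-- `Aᵀ (A Aᵀ)⁻¹` is a right inverse of `A` when `A Aᵀ` is invertible. -/
theorem toEuclideanLin_transpose_mul_inv_apply {m n : ℕ} {A : Matrix (Fin m) (Fin n) ℝ}
    (hA : IsUnit (A * Aᵀ).det) (v : EuclideanSpace ℝ (Fin m)) :
    Matrix.toEuclideanLin A (Matrix.toEuclideanLin (Aᵀ * (A * Aᵀ)⁻¹) v) = v := by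
  have h : A * (Aᵀ * (A * Aᵀ)⁻¹) = 1 := by
    rw [← Matrix.mul_assoc, Matrix.mul_nonsing_inv _ hA]
  simp [Matrix.toLpLin_apply, Matrix.mulVec_mulVec, h]

/-- Asymptotic stability of the constraint manifold for the practical SNDE
`u' = f (u) - γ G (u)⁺ g (u)` with the Moore–Penrose pseudoinverse
`G (u)⁺ = G (u)ᵀ (G (u) G (u)ᵀ)⁻¹` as stabilization matrix: if
`‖G (u t) f (u t)‖ ≤ γ₀ ‖g (u t)‖` along the solution, then
`‖g (u t)‖ ≤ ‖g (u 0)‖ exp ((γ₀ - γ) t)`; in particular `g (u t) → 0`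
whenever `γ > γ₀`. -/
theorem stmt_8 (n m : ℕ) (hn : 0 < n) (hm : 0 < m) (hmn : m ≤ n)
    (f : EuclideanSpace ℝ (Fin n) → EuclideanSpace ℝ (Fin n))
    (γ γ₀ : ℝ) (hγ : 0 ≤ γ) (hγ₀ : 0 < γ₀)
    (g : EuclideanSpace ℝ (Fin n) → EuclideanSpace ℝ (Fin m))
    (G : EuclideanSpace ℝ (Fin n) → Matrix (Fin m) (Fin n) ℝ)
    (hg : ∀ x : EuclideanSpace ℝ (Fin n),
      HasFDerivAt g ((Matrix.toEuclideanLin (G x)).toContinuousLinearMap) x)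
    (u : ℝ → EuclideanSpace ℝ (Fin n))
    (hinv : ∀ t : ℝ, 0 ≤ t → IsUnit (G (u t) * (G (u t))ᵀ).det)
    (hbound : ∀ t : ℝ, 0 ≤ t →
      ‖Matrix.toEuclideanLin (G (u t)) (f (u t))‖ ≤ γ₀ * ‖g (u t)‖)
    (hu : ∀ t : ℝ, 0 ≤ t → HasDerivWithinAt u
      (f (u t) - γ • Matrix.toEuclideanLin
        ((G (u t))ᵀ * (G (u t) * (G (u t))ᵀ)⁻¹) (g (u t)))
      (Set.Ici (0 : ℝ)) t) :
    (∀ t : ℝ, 0 ≤ t →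
      ‖g (u t)‖ ≤ ‖g (u 0)‖ * Real.exp ((γ₀ - γ) * t)) ∧
    (γ₀ < γ → Filter.Tendsto (fun t => g (u t)) Filter.atTop (nhds 0)) := by
  have hw : ∀ t, 0 ≤ t → HasDerivWithinAt (fun t => g (u t))
      (Matrix.toEuclideanLin (G (u t)) (f (u t)) - γ • g (u t)) (Set.Ici 0) t := by
    intro t ht
    have h := (hg (u t)).comp_hasDerivWithinAt t (hu t ht)
    rwa [LinearMap.coe_toContinuousLinearMap', map_sub, map_smul,
      toEuclideanLin_transpose_mul_inv_apply (hinv t ht)] at h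
  have hexp : ∀ t : ℝ, 0 ≤ t → ‖g (u t)‖ ≤ ‖g (u 0)‖ * Real.exp ((γ₀ - γ) * t) :=
    fun t ht => norm_le_mul_exp_of_hasDerivWithinAt hw hbound ht
  refine ⟨hexp, fun hlt => squeeze_zero_norm' (Filter.eventually_atTop.2 ⟨0, hexp⟩) ?_⟩
  have hlim : Filter.Tendsto (fun t : ℝ => (γ₀ - γ) * t) Filter.atTop Filter.atBot :=
    Filter.tendsto_id.const_mul_atTop_of_neg (sub_neg.2 hlt)
  simpa using (Real.tendsto_exp_atBot.comp hlim).const_mul ‖g (u 0)‖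
end

section
/- Let n, m be positive integers with m ≤ n, let e : ℝⁿ → ℝᵐ be differentiable with Jacobian matrix J(θ) ∈ ℝ^{m×n} at each θ, let p : ℝ → ℝᵐ be differentiable, and let θ : ℝ → ℝⁿ be a differentiable curve such that for all t, J(θ(t))·J(θ(t))ᵀ is invertible and θ'(t) = J(θ(t))ᵀ·(J(θ(t))·J(θ(t))ᵀ)⁻¹·p'(t). If e(θ(0)) = p(0), then e(θ(t)) = p(t) for all t. (The minimum-norm inverse-kinematics control law keeps the endpoint of the robot arm exactly on the prescribed path, i.e., the time-dependent constraint manifold {(θ,t) : e(θ) − p(t) = 0} is invariant under these dynamics.) -/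
open Matrix

/-- The minimum-norm inverse-kinematics control law
`θ' = J (θ)ᵀ (J (θ) J (θ)ᵀ)⁻¹ p'` keeps the endpoint of the robot arm exactly on
the prescribed path: if `e (θ 0) = p 0` then `e (θ t) = p t` for all `t`.
Here `J (θ)` is the Jacobian matrix of the endpoint map `e`. -/
theorem stmt_12 (n m : ℕ) (hn : 0 < n) (hm : 0 < m) (hmn : m ≤ n)
    (e : EuclideanSpace ℝ (Fin n) → EuclideanSpace ℝ (Fin m))
    (J : EuclideanSpace ℝ (Fin n) → Matrix (Fin m) (Fin n) ℝ)
    (he : ∀ x : EuclideanSpace ℝ (Fin n),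
      HasFDerivAt e ((Matrix.toEuclideanLin (J x)).toContinuousLinearMap) x)
    (p p' : ℝ → EuclideanSpace ℝ (Fin m))
    (hp : ∀ t : ℝ, HasDerivAt p (p' t) t)
    (θ : ℝ → EuclideanSpace ℝ (Fin n))
    (hinv : ∀ t : ℝ, IsUnit (J (θ t) * (J (θ t))ᵀ).det)
    (hθ : ∀ t : ℝ, HasDerivAt θ
      (Matrix.toEuclideanLin ((J (θ t))ᵀ * (J (θ t) * (J (θ t))ᵀ)⁻¹) (p' t)) t)
    (h0 : e (θ 0) = p 0) :
    ∀ t : ℝ, e (θ t) = p t := by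
  have hder (t : ℝ) : HasDerivAt (fun s => e (θ s) - p s) 0 t := by
    have h := ((he (θ t)).comp_hasDerivAt t (hθ t)).sub (hp t)
    have hcancel : (Matrix.toEuclideanLin (J (θ t))).toContinuousLinearMap
        (Matrix.toEuclideanLin ((J (θ t))ᵀ * (J (θ t) * (J (θ t))ᵀ)⁻¹) (p' t)) = p' t := by
      simp [Matrix.toLpLin_apply, Matrix.mulVec_mulVec, ← Matrix.mul_assoc,
        Matrix.mul_nonsing_inv _ (hinv t)]
    rw [hcancel, sub_self] at h
    exact h
  intro t
  have hconst := is_const_of_deriv_eq_zero (fun s => (hder s).differentiableAt)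
    (fun s => (hder s).deriv) t 0
  simpa [h0, sub_eq_zero] using hconst
end
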